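/- Let Ω ⊂ ℝⁿ be a Lipschitz domain with constants m, r₀, Q = Ω × (0,∞), and L a nondivergence parabolic operator with ellipticity constant ν. Let Y = (y,s) ∈ ∂_pQ and 0 < r ≤ r₀/2, and let u be a function continuous and bounded on cl(Q_{2r}(Y)), solving Lu = 0 in Q_{2r}(Y) and equal to 0 at every point of Δ_{2r}(Y). Then there is a constant θ = θ(n,ν,m) ∈ (0,1) such that the positive and negative parts u^± = max(±u, 0) satisfy sup over Q_r(Y) of u^± ≤ θ · sup over Q_{2r}(Y) of u^±. -/

import Mathlib

open MeasureTheory Set Metric Filter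

noncomputable section

/-- Euclidean space `ℝⁿ`. -/
abbrev E (n : ℕ) : Type := EuclideanSpace ℝ (Fin n)

/-- Second spatial partial derivative `D_i D_j u` at a space-time point `X`. -/
def D2 {n : ℕ} (u : E n × ℝ → ℝ) (X : E n × ℝ) (i j : Fin n) : ℝ :=
  fderiv ℝ (fun x => fderiv ℝ (fun x' => u (x', X.2)) x (EuclideanSpace.single j 1))
    X.1 (EuclideanSpace.single i 1)

/-- Time derivative `D_t u` at a space-time point `X`. -/
def Dt {n : ℕ} (u : E n × ℝ → ℝ) (X : E n × ℝ) : ℝ :=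
  deriv (fun t => u (X.1, t)) X.2

/-- The value `Lu(X)` of the nondivergence parabolic operator with coefficients `a`. -/
def LVal {n : ℕ} (a : E n × ℝ → Fin n → Fin n → ℝ) (u : E n × ℝ → ℝ) (X : E n × ℝ) : ℝ :=
  (∑ i, ∑ j, a X i j * D2 u X i j) - Dt u X

/-- `u` is C² in `x` and C¹ in `t` at every point of `V`. -/
def ParabolicSmoothOn {n : ℕ} (u : E n × ℝ → ℝ) (V : Set (E n × ℝ)) : Prop :=
  ∀ X ∈ V, ContDiffAt ℝ 2 (fun x => u (x, X.2)) X.1 ∧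
    DifferentiableAt ℝ (fun t => u (X.1, t)) X.2

/-- `u` solves `Lu = 0` pointwise in `V` (being C² in `x`, C¹ in `t` there). -/
def SolvesL {n : ℕ} (a : E n × ℝ → Fin n → Fin n → ℝ) (u : E n × ℝ → ℝ)
    (V : Set (E n × ℝ)) : Prop :=
  ParabolicSmoothOn u V ∧ ∀ X ∈ V, LVal a u X = 0

/-- `a` is a smooth coefficient matrix on `S`, uniformly elliptic with constant `ν`
and with entries bounded by `ν⁻¹`. -/
def IsParabolicCoeff {n : ℕ} (ν : ℝ) (a : E n × ℝ → Fin n → Fin n → ℝ)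
    (S : Set (E n × ℝ)) : Prop :=
  (∀ i j, ContDiffOn ℝ (⊤ : ℕ∞) (fun X => a X i j) S) ∧
  ∀ X ∈ S, (∀ ξ : Fin n → ℝ, ν * ∑ i, ξ i ^ 2 ≤ ∑ i, ∑ j, a X i j * ξ i * ξ j) ∧
    ∀ i j, |a X i j| ≤ ν⁻¹

/-- The cylinder `Ω × (t₀, ∞)`. -/
def CylFrom {n : ℕ} (Ω : Set (E n)) (t₀ : ℝ) : Set (E n × ℝ) := Ω ×ˢ Ioi t₀

/-- The cylinder `Q = Ω × (0, ∞)`. -/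
def Cyl {n : ℕ} (Ω : Set (E n)) : Set (E n × ℝ) := CylFrom Ω 0

/-- Parabolic boundary of the cylinder `Ω × (t₀, ∞)`:
`(∂Ω × (t₀,∞)) ∪ (cl(Ω) × {t₀})`. -/
def pBFrom {n : ℕ} (Ω : Set (E n)) (t₀ : ℝ) : Set (E n × ℝ) :=
  (frontier Ω ×ˢ Ioi t₀) ∪ (closure Ω ×ˢ {t₀})

/-- Parabolic boundary of `Ω × (0, ∞)`. -/
def pB {n : ℕ} (Ω : Set (E n)) : Set (E n × ℝ) := pBFrom Ω 0

/-- The cylinder `C_{R,r}(Y) = B_R(y) × (s - r², s + r²)`. -/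
def CRr {n : ℕ} (Y : E n × ℝ) (R r : ℝ) : Set (E n × ℝ) :=
  ball Y.1 R ×ˢ Ioo (Y.2 - r ^ 2) (Y.2 + r ^ 2)

/-- The standard cylinder `C_r(Y) = B_r(y) × (s - r², s + r²)`. -/
def Cr {n : ℕ} (Y : E n × ℝ) (r : ℝ) : Set (E n × ℝ) := CRr Y r r

/-- `ω` is the `L`-caloric measure family for the cylinder `Ω × (t₀, ∞)`:
each `ω X` is a Borel probability measure on the parabolic boundary, and for every
bounded continuous `φ`, `X ↦ ∫ φ dω^X` is a (bounded) solution of `Lu = 0` in the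
cylinder extending continuously to `φ` at each point of the parabolic boundary. -/
def IsCaloricMeasureFrom {n : ℕ} (a : E n × ℝ → Fin n → Fin n → ℝ) (Ω : Set (E n))
    (t₀ : ℝ) (ω : E n × ℝ → Measure (E n × ℝ)) : Prop :=
  (∀ X ∈ CylFrom Ω t₀, IsProbabilityMeasure (ω X) ∧ ω X (pBFrom Ω t₀)ᶜ = 0) ∧
  ∀ φ : E n × ℝ → ℝ, Continuous φ → (∃ M, ∀ z, |φ z| ≤ M) →
    SolvesL a (fun X => ∫ z, φ z ∂ω X) (CylFrom Ω t₀) ∧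
    ∀ Z ∈ pBFrom Ω t₀, Tendsto (fun X => ∫ z, φ z ∂ω X)
      (nhdsWithin Z (CylFrom Ω t₀)) (nhds (φ Z))

/-- `ω` is the `L`-caloric measure family for `Q = Ω × (0, ∞)`. -/
def IsCaloricMeasure {n : ℕ} (a : E n × ℝ → Fin n → Fin n → ℝ) (Ω : Set (E n))
    (ω : E n × ℝ → Measure (E n × ℝ)) : Prop :=
  IsCaloricMeasureFrom a Ω 0 ω

/-- `Ω` is a Lipschitz domain with constants `m, r₀ > 0`: it is a nonempty open
connected set and near each boundary point, in a suitable orthonormal coordinate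
system centered at that point, it coincides with the region above the graph of a
function with `‖∇φ‖_{L^∞} ≤ m` (equivalently, `m`-Lipschitz). -/
def IsLipschitzDomain {n : ℕ} (hn : 0 < n) (Ω : Set (E n)) (m r₀ : ℝ) : Prop :=
  IsOpen Ω ∧ Ω.Nonempty ∧ IsConnected Ω ∧ 0 < m ∧ 0 < r₀ ∧
  ∀ y ∈ frontier Ω, ∃ (T : E n ≃ₗᵢ[ℝ] E n) (φ : E (n - 1) → ℝ),
    LipschitzWith m.toNNReal φ ∧
    ∀ x : E n, x ∈ Ω ∩ ball y r₀ ↔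
      ‖x - y‖ < r₀ ∧
        φ ((EuclideanSpace.equiv (Fin (n - 1)) ℝ).symm
            (fun i => T (x - y) (Fin.castLE (Nat.sub_le n 1) i))) <
          T (x - y) ⟨n - 1, Nat.sub_lt hn Nat.one_pos⟩

/-- The set `Ω^δ = {x ∈ Ω : dist(x, ∂Ω) > δ}`. -/
def innerSet {n : ℕ} (Ω : Set (E n)) (δ : ℝ) : Set (E n) :=
  {x ∈ Ω | δ < infDist x (frontier Ω)}

/-- The corkscrew property (2.3) with constant `μ`. -/
def Corkscrew {n : ℕ} (Ω : Set (E n)) (r₀ μ : ℝ) : Prop :=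
  ∀ y ∈ frontier Ω, ∀ r : ℝ, 0 < r → r < r₀ →
    (∃ y₁ : E n, ball y₁ (2 * μ * r) ⊆ ball y r ∩ Ω) ∧
    (∃ y₂ : E n, ball y₂ (2 * μ * r) ⊆ ball y r \ Ω)

theorem snd_test_line (φ φ' : ℝ → ℝ) (A : ℝ) (h1 : ∀ᶠ s in nhds (0:ℝ), HasDerivAt φ (φ' s) s)
    (h2 : HasDerivAt φ' A 0) (hm : IsLocalMax φ 0) : A ≤ 0 := by
  by_contra hA
  push Not at hA
  have hEq : deriv φ =ᶠ[nhds 0] φ' := h1.mono fun s hs => hs.deriv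
  have hdd : deriv (deriv φ) 0 = A := by rw [hEq.deriv_eq, h2.deriv]
  have hmin : IsLocalMin φ 0 :=
    isLocalMin_of_deriv_deriv_pos (by rw [hdd]; exact hA) hm.deriv_eq_zero
      h1.self_of_nhds.continuousAt
  have hc : φ =ᶠ[nhds 0] fun _ => φ 0 := by
    filter_upwards [hm, hmin] with s hs1 hs2 using le_antisymm hs1 hs2
  have h3 : deriv φ =ᶠ[nhds 0] fun _ => 0 := by
    have := hc.deriv
    simpa using this
  have : deriv (deriv φ) 0 = 0 := by rw [h3.deriv_eq]; simp
  linarith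

theorem snd_test {n : ℕ} (F : E n → ℝ) (x ξ : E n) (hF : ContDiffAt ℝ 2 F x)
    (hm : IsLocalMax F x) : fderiv ℝ (fderiv ℝ F) x ξ ξ ≤ 0 := by
  have hl : ∀ s : ℝ, HasDerivAt (fun s : ℝ => x + s • ξ) ξ s := fun s => by
    simpa using ((hasDerivAt_id s).smul_const ξ).const_add x
  have hc : Tendsto (fun s : ℝ => x + s • ξ) (nhds 0) (nhds x) := by
    have := (hl 0).continuousAt.tendsto
    simpa using this
  have hd : ∀ᶠ x' in nhds x, DifferentiableAt ℝ F x' := by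
    have := hF.eventually (by simp)
    exact this.mono fun y hy => hy.differentiableAt (by simp)
  have hd2 : DifferentiableAt ℝ (fderiv ℝ F) x :=
    (hF.fderiv_right (m := 1) (by norm_num)).differentiableAt (by simp)
  refine snd_test_line (fun s => F (x + s • ξ)) (fun s => fderiv ℝ F (x + s • ξ) ξ) _ ?_ ?_ ?_
  · filter_upwards [hc.eventually hd] with s hs
    exact hs.hasFDerivAt.comp_hasDerivAt s (hl s)
  · have h0 : HasFDerivAt (fderiv ℝ F) (fderiv ℝ (fderiv ℝ F) x) (x + (0:ℝ) • ξ) := by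
      simpa using hd2.hasFDerivAt
    have := h0.comp_hasDerivAt 0 (hl 0)
    exact this.clm_apply (hasDerivAt_const (0:ℝ) ξ) |>.congr_deriv (by simp)
  · have := hc.eventually hm
    simpa [IsLocalMax, IsMaxFilter] using this

theorem D2_eq {n : ℕ} (u : E n × ℝ → ℝ) (X : E n × ℝ)
    (hF : ContDiffAt ℝ 2 (fun x => u (x, X.2)) X.1) (i j : Fin n) :
    D2 u X i j = fderiv ℝ (fderiv ℝ (fun x => u (x, X.2))) X.1 (EuclideanSpace.single i 1)
      (EuclideanSpace.single j 1) := by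
  have hd2 : DifferentiableAt ℝ (fderiv ℝ (fun x => u (x, X.2))) X.1 :=
    (hF.fderiv_right (m := 1) (by norm_num)).differentiableAt (by simp)
  unfold D2
  rw [fderiv_clm_apply hd2 (by fun_prop)]
  simp

theorem trace_nonpos {n : ℕ} (a H : Fin n → Fin n → ℝ) (hs : ∀ i j, H i j = H j i)
    (ha : ∀ ξ : Fin n → ℝ, 0 ≤ ∑ i, ∑ j, a i j * ξ i * ξ j)
    (hH : ∀ ξ : Fin n → ℝ, ∑ i, ∑ j, H i j * ξ i * ξ j ≤ 0) :
    ∑ i, ∑ j, a i j * H i j ≤ 0 := by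
  have hp : (Matrix.of (fun i j => - H i j)).PosSemidef := by
    refine .of_dotProduct_mulVec_nonneg ?_ ?_
    · ext i j
      simp [Matrix.conjTranspose, hs i j]
    · intro x
      have := hH x
      simp only [dotProduct, Matrix.mulVec, Matrix.of_apply, star_trivial, Finset.mul_sum]
      have e : ∑ i, ∑ j, x i * (-H i j * x j) = - ∑ i, ∑ j, H i j * x i * x j := by
        simp only [← Finset.sum_neg_distrib]
        refine Finset.sum_congr rfl fun i _ => Finset.sum_congr rfl fun j _ => by ring
      rw [e]; linarith
  obtain ⟨k, v, hv⟩ := Matrix.posSemidef_iff_eq_sum_vecMulVec.mp hp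
  have hv' : ∀ i j, H i j = - ∑ l, v l i * v l j := by
    intro i j
    have := congrFun (congrFun hv i) j
    simp [Matrix.sum_apply, Matrix.vecMulVec_apply] at this
    linarith
  have e : ∑ i, ∑ j, a i j * H i j = - ∑ l, ∑ i, ∑ j, a i j * v l i * v l j := by
    rw [Finset.sum_comm (s := (Finset.univ : Finset (Fin k))), ← Finset.sum_neg_distrib]
    refine Finset.sum_congr rfl fun i _ => ?_
    rw [Finset.sum_comm, ← Finset.sum_neg_distrib]
    refine Finset.sum_congr rfl fun j _ => ?_
    rw [hv' i j, mul_neg, Finset.mul_sum]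
    congr 1
    refine Finset.sum_congr rfl fun l _ => by ring
  rw [e, neg_nonpos]
  exact Finset.sum_nonneg fun l _ => ha (v l)

/-- derivatives of the barrier profile. -/
theorem psi_fderiv {n : ℕ} (z : E n) (R : ℝ) (x : E n) :
    HasFDerivAt (fun x : E n => (R - ‖x - z‖ ^ 2) ^ 2)
      ((-4 * (R - ‖x - z‖ ^ 2)) • innerSL ℝ (x - z)) x := by
  have h1 : HasFDerivAt (fun x : E n => ‖x - z‖ ^ 2) (2 • innerSL ℝ (x - z)) x := by
    have := ((hasFDerivAt_id x).sub_const z).norm_sq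
    refine this.congr_fderiv ?_
    ext w; simp
  refine ((h1.const_sub R).pow 2).congr_fderiv ?_
  ext w
  simp
  ring

theorem psi_fderiv2 {n : ℕ} (z : E n) (R : ℝ) (x ξ w : E n) :
    fderiv ℝ (fderiv ℝ (fun x : E n => (R - ‖x - z‖ ^ 2) ^ 2)) x ξ w =
      8 * inner ℝ (x - z) ξ * inner ℝ (x - z) w - 4 * (R - ‖x - z‖ ^ 2) * inner ℝ ξ w := by
  have e : fderiv ℝ (fun x : E n => (R - ‖x - z‖ ^ 2) ^ 2) =
      fun x => (-4 * (R - ‖x - z‖ ^ 2)) • innerSL ℝ (x - z) := by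
    funext x; exact (psi_fderiv z R x).fderiv
  rw [e]
  have h1 : HasFDerivAt (fun x : E n => ‖x - z‖ ^ 2) (2 • innerSL ℝ (x - z)) x := by
    have := ((hasFDerivAt_id x).sub_const z).norm_sq
    refine this.congr_fderiv ?_
    ext w; simp
  have h2 : HasFDerivAt (fun x : E n => innerSL ℝ (x - z)) (innerSL ℝ : E n →L[ℝ] E n →L[ℝ] ℝ) x :=
    HasFDerivAt.comp (g := (innerSL ℝ : E n →L[ℝ] E n →L[ℝ] ℝ)) x
      (innerSL ℝ : E n →L[ℝ] E n →L[ℝ] ℝ).hasFDerivAt ((hasFDerivAt_id x).sub_const z)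
  have h3 := ((h1.const_sub R).const_mul (-4)).smul h2
  change HasFDerivAt (fun x => (-4 * (R - ‖x - z‖ ^ 2)) • innerSL ℝ (x - z)) _ x at h3
  rw [h3.fderiv]
  have e5 : innerSL ℝ ξ w = inner ℝ ξ w := rfl
  simp [inner_sub_left, e5]
  ring

theorem psi_contDiff {n : ℕ} (z : E n) (R : ℝ) :
    ContDiff ℝ 2 (fun x : E n => (R - ‖x - z‖ ^ 2) ^ 2) :=
  (contDiff_const.sub ((contDiff_id.sub contDiff_const).norm_sq ℝ)).pow 2

theorem bilin_expand {n : ℕ} (B : E n →L[ℝ] E n →L[ℝ] ℝ) (ξ : Fin n → ℝ) :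
    ∑ i, ∑ j, B (EuclideanSpace.single i 1) (EuclideanSpace.single j 1) * ξ i * ξ j =
      B (WithLp.toLp 2 ξ) (WithLp.toLp 2 ξ) := by
  have e : (WithLp.toLp 2 ξ : E n) = ∑ i, ξ i • EuclideanSpace.single i (1:ℝ) := by
    ext k
    simp [Finset.sum_apply, Pi.single_apply]
  rw [e]
  simp only [map_sum, map_smul, _root_.sum_apply, _root_.smul_apply,
    smul_eq_mul, Finset.mul_sum]
  rw [Finset.sum_comm]
  refine Finset.sum_congr rfl fun i _ => Finset.sum_congr rfl fun j _ => by ring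

theorem deriv_left_max (f : ℝ → ℝ) (f' t : ℝ) (hf : HasDerivAt f f' t)
    (h : ∀ᶠ t' in nhdsWithin t (Iio t), f t' ≤ f t) : 0 ≤ f' := by
  have h1 := (hasDerivWithinAt_iff_tendsto_slope' (s := Iio t) (by simp)).mp
    (hf.hasDerivWithinAt)
  refine ge_of_tendsto h1 ?_
  filter_upwards [h, self_mem_nhdsWithin] with t' h1 h2
  rw [slope_def_field]
  exact div_nonneg_of_nonpos (by linarith) (by simp at h2; linarith)

theorem interior_max {n : ℕ} (ν : ℝ) (hν : 0 < ν) (a : E n × ℝ → Fin n → Fin n → ℝ)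
    (u : E n × ℝ → ℝ) (x : E n) (t : ℝ)
    (ha1 : ∀ ξ : Fin n → ℝ, ν * ∑ i, ξ i ^ 2 ≤ ∑ i, ∑ j, a (x, t) i j * ξ i * ξ j)
    (ha2 : ∀ i j, |a (x, t) i j| ≤ ν⁻¹)
    (hu1 : ContDiffAt ℝ 2 (fun x => u (x, t)) x)
    (hu2 : DifferentiableAt ℝ (fun t => u (x, t)) t)
    (hL : LVal a u (x, t) = 0) (z : E n) (b s k C : ℝ) (hC : 0 < C)
    (hg : 0 < b + (t - s) / 2 - ‖x - z‖ ^ 2)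
    (hmx : IsLocalMax (fun x' => u (x', t) +
      C * Real.exp (-(k * (t - s))) * (b + (t - s) / 2 - ‖x' - z‖ ^ 2) ^ 2) x)
    (hmt : ∀ᶠ t' in nhdsWithin t (Iio t), u (x, t') +
      C * Real.exp (-(k * (t' - s))) * (b + (t' - s) / 2 - ‖x - z‖ ^ 2) ^ 2 ≤
      u (x, t) + C * Real.exp (-(k * (t - s))) * (b + (t - s) / 2 - ‖x - z‖ ^ 2) ^ 2) :
    8 * ν * ‖x - z‖ ^ 2 - (4 * n * ν⁻¹ + 1) * (b + (t - s) / 2 - ‖x - z‖ ^ 2)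
      + k * (b + (t - s) / 2 - ‖x - z‖ ^ 2) ^ 2 ≤ 0 := by
  set c := C * Real.exp (-(k * (t - s))) with hc
  have hcpos : 0 < c := by positivity
  set R := b + (t - s) / 2 with hR
  set g := R - ‖x - z‖ ^ 2 with hgdef
  -- time derivative
  have htime : 0 ≤ Dt u (x, t) + c * (g - k * g ^ 2) := by
    refine deriv_left_max _ _ t ?_ hmt
    have h1 : HasDerivAt (fun t' : ℝ => Real.exp (-(k * (t' - s))))
        (Real.exp (-(k * (t - s))) * (-(k * 1))) t :=
      ((((hasDerivAt_id t).sub_const s).const_mul k).neg).exp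
    have h2 : HasDerivAt (fun t' : ℝ => (b + (t' - s) / 2 - ‖x - z‖ ^ 2) ^ 2)
        (2 * g * (1 / 2)) t := by
      refine ((((((hasDerivAt_id t).sub_const s).div_const 2).const_add b).sub_const
        (‖x - z‖ ^ 2)).pow 2).congr_deriv ?_
      simp [hgdef, hR]
    refine (hu2.hasDerivAt.add ((h1.const_mul C).mul h2)).congr_deriv ?_
    simp only [Dt, hc, hgdef, hR]
    ring
  -- space derivative
  set ψ : E n → ℝ := fun x' => (R - ‖x' - z‖ ^ 2) ^ 2 with hψ
  set f : E n → ℝ := fun x' => u (x', t) with hf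
  have hψc : ContDiff ℝ 2 ψ := psi_contDiff z R
  have hFc : ContDiffAt ℝ 2 (fun x' => f x' + c * ψ x') x :=
    hu1.add (contDiffAt_const.mul hψc.contDiffAt)
  set B := fderiv ℝ (fderiv ℝ (fun x' => f x' + c * ψ x')) x with hB
  have hBeq : B = fderiv ℝ (fderiv ℝ f) x + c • fderiv ℝ (fderiv ℝ ψ) x := by
    have e : fderiv ℝ (fun x' => f x' + c * ψ x') =ᶠ[nhds x]
        fun x' => fderiv ℝ f x' + c • fderiv ℝ ψ x' := by
      have := hu1.eventually (by simp)
      filter_upwards [this] with y hy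
      have hy1 : DifferentiableAt ℝ f y := hy.differentiableAt (by simp)
      have hy2 : DifferentiableAt ℝ ψ y := hψc.contDiffAt.differentiableAt (by simp)
      exact (hy1.hasFDerivAt.add (hy2.hasFDerivAt.const_mul c)).fderiv
    rw [hB, e.fderiv_eq]
    have hd1 : DifferentiableAt ℝ (fderiv ℝ f) x :=
      (hu1.fderiv_right (m := 1) (by norm_num)).differentiableAt (by simp)
    have hd2 : DifferentiableAt ℝ (fderiv ℝ ψ) x :=
      (hψc.contDiffAt.fderiv_right (m := 1) (by norm_num)).differentiableAt (by simp)
    exact (hd1.hasFDerivAt.add (hd2.hasFDerivAt.const_smul c)).fderiv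
  have htr := trace_nonpos (a (x, t))
    (fun i j => B (EuclideanSpace.single i 1) (EuclideanSpace.single j 1))
    (fun i j => (hFc.isSymmSndFDerivAt (by simp)) _ _)
    (fun ξ => le_trans (mul_nonneg hν.le (Finset.sum_nonneg fun i _ => sq_nonneg _)) (ha1 ξ))
    (fun ξ => by
      rw [bilin_expand]
      exact snd_test _ x _ hFc hmx)
  have hHij : ∀ i j, B (EuclideanSpace.single i 1) (EuclideanSpace.single j 1) =
      D2 u (x, t) i j + c * (8 * ((x - z) i * (x - z) j) - 4 * g * (if i = j then 1 else 0)) := by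
    intro i j
    rw [hBeq, D2_eq u (x, t) hu1]
    simp only [_root_.add_apply, _root_.smul_apply, smul_eq_mul]
    congr 1
    rw [hψ, psi_fderiv2]
    have e1 : ∀ (v : E n) (i : Fin n), inner ℝ v (EuclideanSpace.single i (1:ℝ)) = v i := by
      intro v i
      simp [EuclideanSpace.inner_single_right]
    rw [e1, e1, e1]
    simp only [PiLp.single_apply, eq_comm]
    ring
  have hsum : ∑ i, ∑ j, a (x, t) i j *
      B (EuclideanSpace.single i 1) (EuclideanSpace.single j 1) =
      ∑ i, ∑ j, a (x, t) i j * D2 u (x, t) i j +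
      c * (8 * ∑ i, ∑ j, a (x, t) i j * (x - z) i * (x - z) j - 4 * g * ∑ i, a (x, t) i i) := by
    have e2 : ∑ i, a (x, t) i i = ∑ i, ∑ j, a (x, t) i j * (if i = j then 1 else 0) := by
      refine Finset.sum_congr rfl fun i _ => by simp
    rw [e2]
    simp only [hHij, Finset.mul_sum, ← Finset.sum_add_distrib, ← Finset.sum_sub_distrib]
    refine Finset.sum_congr rfl fun i _ => Finset.sum_congr rfl fun j _ => by ring
  have hn2 : ∑ i, ((x - z) i) ^ 2 = ‖x - z‖ ^ 2 := by
    rw [EuclideanSpace.norm_sq_eq]; simp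
  have hq := ha1 (fun i => (x - z) i)
  rw [hn2] at hq
  have htrace : ∑ i, a (x, t) i i ≤ n * ν⁻¹ := by
    calc ∑ i, a (x, t) i i ≤ ∑ i : Fin n, ν⁻¹ :=
          Finset.sum_le_sum fun i _ => (le_abs_self _).trans (ha2 i i)
      _ = n * ν⁻¹ := by simp
  rw [hsum] at htr
  unfold LVal at hL
  have hkey : c * (8 * ∑ i, ∑ j, a (x, t) i j * (x - z) i * (x - z) j
      - 4 * g * ∑ i, a (x, t) i i - g + k * g ^ 2) ≤ 0 := by linarith
  have hkey2 := nonpos_of_mul_nonpos_right hkey hcpos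
  have := mul_le_mul_of_nonneg_left htrace (show 0 ≤ 4 * g by linarith)
  linarith

set_option maxHeartbeats 1000000 in
theorem core {n : ℕ} (ν : ℝ) (hν : 0 < ν) (β K : ℝ) (hβ : 0 < β)
    (hK : K = (8 * ν + 4 * n * ν⁻¹ + 1) ^ 2 / (16 * ν * β))
    (Ω : Set (E n)) (hΩ : IsOpen Ω)
    (a : E n × ℝ → Fin n → Fin n → ℝ) (ha : IsParabolicCoeff ν a (closure (Cyl Ω)))
    (y : E n) (s : ℝ) (r : ℝ) (hr : 0 < r) (z : E n) (b : ℝ)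
    (hz : ‖z - y‖ ≤ r / 8) (hb1 : 2 * r ^ 2 ≤ b) (hb2 : b ≤ 2.02 * r ^ 2)
    (hpos : ∀ t, 0 ≤ t → s - 4 * r ^ 2 ≤ t → β * r ^ 2 ≤ b + (t - s) / 2)
    (hinit : 0 ≤ s - 4 * r ^ 2 → ∀ x ∈ closure Ω, ‖x - y‖ < 2 * r → b - 2 * r ^ 2 ≤ ‖x - z‖ ^ 2)
    (u : E n × ℝ → ℝ) (hu : ContinuousOn u (closure (Cyl Ω ∩ Cr (y, s) (2 * r))))
    (hS : SolvesL a u (Cyl Ω ∩ Cr (y, s) (2 * r)))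
    (h0 : ∀ Z ∈ pB Ω ∩ Cr (y, s) (2 * r), u Z = 0)
    (M : ℝ) (hM : 0 < M) (huM : ∀ X ∈ Cyl Ω ∩ Cr (y, s) (2 * r), u X ≤ M) :
    ∀ X ∈ Cyl Ω ∩ Cr (y, s) r, u X ≤ (1 - Real.exp (-(5 * K)) / 225) * M := by
  have hK0 : 0 < K := by rw [hK]; positivity
  have hr2 : 0 < r ^ 2 := by positivity
  set S := Cyl Ω ∩ Cr (y, s) (2 * r) with hSdef
  set k := K / r ^ 2 with hk
  have hk0 : 0 < k := by positivity
  have hkr : k * r ^ 2 = K := by rw [hk]; field_simp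
  set c := Real.exp (-(4 * K)) / (9 * r ^ 4) with hc
  have hc0 : 0 < c := by positivity
  set g : E n × ℝ → ℝ := fun X => b + (X.2 - s) / 2 - ‖X.1 - z‖ ^ 2 with hg
  have hgc : Continuous g := by rw [hg]; fun_prop
  set v : E n × ℝ → ℝ := fun X => Real.exp (-(k * (X.2 - s))) * (max (g X) 0) ^ 2 with hv
  have hvc : Continuous v := by rw [hv]; fun_prop
  have huM' : ∀ X ∈ closure S, u X ≤ M := by
    intro X hX
    have : (nhdsWithin X S).NeBot := mem_closure_iff_nhdsWithin_neBot.mp hX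
    have h1 : Tendsto u (nhdsWithin X S) (nhds (u X)) :=
      ((hu X hX).mono_left (nhdsWithin_mono _ subset_closure))
    exact le_of_tendsto h1 (by filter_upwards [self_mem_nhdsWithin] with Z hZ using huM Z hZ)
  -- location of the closure
  have hcl : ∀ X ∈ closure S, X.1 ∈ closure Ω ∧ 0 ≤ X.2 ∧ X.1 ∈ closedBall y (2 * r) ∧
      s - 4 * r ^ 2 ≤ X.2 ∧ X.2 ≤ s + 4 * r ^ 2 := by
    have hsub : closure S ⊆ (closure Ω ×ˢ Ici (0:ℝ)) ∩
        (closedBall y (2 * r) ×ˢ Icc (s - 4 * r ^ 2) (s + 4 * r ^ 2)) := by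
      refine closure_minimal ?_ ((isClosed_closure.prod isClosed_Ici).inter
        (isClosed_closedBall.prod isClosed_Icc))
      rintro X ⟨⟨hX1, hX2⟩, ⟨hX3, hX4⟩⟩
      simp only [mem_Ioi, mem_Ioo] at hX2 hX4
      refine ⟨⟨subset_closure hX1, le_of_lt hX2⟩, ⟨ball_subset_closedBall hX3, ?_, ?_⟩⟩ <;>
        nlinarith
    intro X hX
    obtain ⟨⟨h1, h2⟩, ⟨h3, h4⟩⟩ := hsub hX
    exact ⟨h1, h2, h3, h4.1, h4.2⟩
  have hScomp : IsCompact (closure S) := by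
    refine IsCompact.of_isClosed_subset
      ((isCompact_closedBall y (2 * r)).prod (isCompact_Icc (a := s - 4 * r ^ 2) (b := s + 4 * r ^ 2)))
      isClosed_closure ?_
    intro X hX
    obtain ⟨h1, h2, h3, h4⟩ := hcl X hX
    exact ⟨h3, h4⟩
  -- upper bound of the barrier
  have hvub : ∀ X : E n × ℝ, s - 4 * r ^ 2 ≤ X.2 → X.2 ≤ s + r ^ 2 → c * v X ≤ 1 := by
    intro X h1 h2
    have e1 : Real.exp (-(k * (X.2 - s))) ≤ Real.exp (4 * K) := by
      apply Real.exp_le_exp.mpr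
      nlinarith
    have e2 : (max (g X) 0) ≤ 3 * r ^ 2 := by
      refine max_le ?_ (by positivity)
      have := sq_nonneg ‖X.1 - z‖
      simp only [hg]; linarith
    have e3 : (max (g X) 0) ^ 2 ≤ (3 * r ^ 2) ^ 2 := pow_le_pow_left₀ (le_max_right _ _) e2 2
    calc c * v X ≤ c * (Real.exp (4 * K) * (3 * r ^ 2) ^ 2) := by
          apply mul_le_mul_of_nonneg_left _ hc0.le
          exact mul_le_mul e1 e3 (by positivity) (by positivity)
      _ = 1 := by
          rw [hc, Real.exp_neg]
          field_simp
          norm_num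
  -- lower bound
  have hvlb : ∀ X ∈ Cyl Ω ∩ Cr (y, s) r, Real.exp (-(5 * K)) / 225 ≤ c * v X := by
    rintro X ⟨-, hX3, hX4⟩
    simp only [mem_Ioo, mem_ball, dist_eq_norm] at hX3 hX4
    have e1 : Real.exp (-K) ≤ Real.exp (-(k * (X.2 - s))) := by
      apply Real.exp_le_exp.mpr
      nlinarith [hX4.2]
    have e2 : ‖X.1 - z‖ ≤ 9 / 8 * r := by
      have : X.1 - z = (X.1 - y) - (z - y) := by abel
      rw [this]
      refine (norm_sub_le _ _).trans (by linarith)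
    have e3 : 1 / 5 * r ^ 2 ≤ max (g X) 0 := by
      refine le_trans ?_ (le_max_left _ _)
      simp only [hg]
      have := pow_le_pow_left₀ (norm_nonneg _) e2 2
      nlinarith [hX4.1]
    have e4 : (1 / 5 * r ^ 2) ^ 2 ≤ (max (g X) 0) ^ 2 := pow_le_pow_left₀ (by positivity) e3 2
    calc Real.exp (-(5 * K)) / 225 = c * (Real.exp (-K) * (1 / 5 * r ^ 2) ^ 2) := by
          have : Real.exp (-(5 * K)) = Real.exp (-(4 * K)) * Real.exp (-K) := by
            rw [← Real.exp_add]; ring_nf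
          rw [this, hc]
          field_simp
          norm_num
      _ ≤ _ := by
          apply mul_le_mul_of_nonneg_left _ hc0.le
          exact mul_le_mul e1 e4 (by positivity) (by positivity)
  -- comparison
  suffices hcmp : ∀ X ∈ Cyl Ω ∩ Cr (y, s) r, u X + M * c * v X ≤ M by
    intro X hX
    have h1 := hcmp X hX
    have h2 := mul_le_mul_of_nonneg_left (hvlb X hX) hM.le
    linarith
  intro X0 hX0
  by_contra hcon
  push Not at hcon
  have hX0S : X0 ∈ S := by
    obtain ⟨h1, h2, h3⟩ := hX0
    simp only [mem_Ioo] at h3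
    refine ⟨h1, ball_subset_ball (by linarith) h2, ?_, ?_⟩ <;> simp only <;> nlinarith [h3.1, h3.2]
  have hX0t : X0.2 < s + r ^ 2 := hX0.2.2.2
  have hKc : IsCompact (closure S ∩ {X | X.2 ≤ X0.2}) :=
    hScomp.inter_right (isClosed_le continuous_snd continuous_const)
  obtain ⟨X1, ⟨hX1S, hX1t⟩, hX1max⟩ := hKc.exists_isMaxOn ⟨X0, subset_closure hX0S, le_refl X0.2⟩
    (f := fun X => u X + M * c * v X)
    ((hu.mono inter_subset_left).add (continuous_const.mul hvc).continuousOn)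
  obtain ⟨x1, t1⟩ := X1
  simp only [mem_ofPred_eq] at hX1t
  have hX1 : M < u (x1, t1) + M * c * v (x1, t1) :=
    lt_of_lt_of_le hcon (hX1max ⟨subset_closure hX0S, le_refl X0.2⟩)
  obtain ⟨hl1, hl2, hl3, hl4, hl5⟩ := hcl _ hX1S
  simp only at hl1 hl2 hl3 hl4 hl5
  have ht1 : t1 < s + r ^ 2 := lt_of_le_of_lt hX1t hX0t
  have hgpos : 0 < g (x1, t1) := by
    by_contra hneg
    push Not at hneg
    have : v (x1, t1) = 0 := by simp [hv, max_eq_right hneg]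
    rw [this] at hX1
    linarith [huM' _ hX1S]
  have hune : u (x1, t1) ≠ 0 := by
    intro h
    rw [h] at hX1
    have := mul_le_mul_of_nonneg_left (hvub (x1, t1) hl4 ht1.le) hM.le
    linarith
  have hgv : b + (t1 - s) / 2 - ‖x1 - z‖ ^ 2 = g (x1, t1) := rfl
  have hx1y : ‖x1 - y‖ < 2 * r := by
    have e1 : ‖x1 - z‖ ≤ 1.6 * r := by
      apply abs_le_of_sq_le_sq' _ (by positivity) |>.2
      nlinarith
    have : x1 - y = (x1 - z) + (z - y) := by abel
    rw [this]
    exact (norm_add_le _ _).trans_lt (by linarith)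
  have ht1s : s - 4 * r ^ 2 < t1 := by
    rcases hl4.lt_or_eq with h | h
    · exact h
    · exfalso
      have := hinit (by linarith) x1 hl1 hx1y
      rw [← h] at hgv
      rw [← h] at hgpos
      linarith
  have hCr : (x1, t1) ∈ Cr (y, s) (2 * r) := by
    refine ⟨by simpa [dist_eq_norm] using hx1y, ?_, ?_⟩ <;> simp only <;> nlinarith
  have ht1pos : 0 < t1 := by
    rcases hl2.lt_or_eq with h | h
    · exact h
    · exact absurd (h0 (x1, t1) ⟨Or.inr ⟨hl1, h.symm⟩, hCr⟩) hune
  have hx1Ω : x1 ∈ Ω := by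
    by_contra h
    refine hune (h0 (x1, t1) ⟨Or.inl ⟨?_, ht1pos⟩, hCr⟩)
    exact ⟨hl1, by simpa [hΩ.interior_eq] using h⟩
  have hX1in : (x1, t1) ∈ S := ⟨⟨hx1Ω, ht1pos⟩, hCr⟩
  have hSo : IsOpen S :=
    (hΩ.prod isOpen_Ioi).inter (isOpen_ball.prod isOpen_Ioo)
  have hnear : ∀ᶠ X in nhds (x1, t1), X ∈ S ∧ 0 < g X :=
    (hSo.eventually_mem hX1in).and (hgc.continuousAt.eventually (lt_mem_nhds hgpos))
  have hcomp : ∀ X : E n × ℝ, X ∈ S ∧ 0 < g X → X.2 ≤ t1 →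
      u X + M * c * Real.exp (-(k * (X.2 - s))) * (g X) ^ 2 ≤
      u (x1, t1) + M * c * Real.exp (-(k * (t1 - s))) * (g (x1, t1)) ^ 2 := by
    rintro X ⟨h1, h2⟩ h3
    have := hX1max ⟨subset_closure h1, h3.trans hX1t⟩
    simp only [hv, mem_ofPred_eq, max_eq_left h2.le, max_eq_left hgpos.le] at this
    linarith
  have hcx : Tendsto (fun x : E n => (x, t1)) (nhds x1) (nhds (x1, t1)) :=
    Continuous.tendsto (by fun_prop) x1
  have hct : Tendsto (fun t : ℝ => (x1, t)) (nhds t1) (nhds (x1, t1)) :=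
    Continuous.tendsto (by fun_prop) t1
  obtain ⟨ha1, ha2⟩ := ha.2 (x1, t1) (subset_closure hX1in.1)
  have hfin := interior_max ν hν a u x1 t1 ha1 ha2 (hS.1 _ hX1in).1 (hS.1 _ hX1in).2
    (hS.2 _ hX1in) z b s k (M * c) (by positivity) hgpos
    ((hcx.eventually hnear).mono fun x hx => hcomp (x, t1) hx le_rfl)
    (by
      filter_upwards [nhdsWithin_le_nhds (hct.eventually hnear), self_mem_nhdsWithin] with t ht ht2
      exact hcomp (x1, t) ht (le_of_lt ht2))
  rw [hgv] at hfin
  have hp := hpos t1 hl2 hl4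
  have hnorm : ‖x1 - z‖ ^ 2 = b + (t1 - s) / 2 - g (x1, t1) := by rw [← hgv]; ring
  rw [hnorm] at hfin
  set q := g (x1, t1) with hq
  set A := 8 * ν + 4 * n * ν⁻¹ + 1 with hA
  have hA0 : 0 < A := by positivity
  have h5 : 8 * ν * (β * r ^ 2) - A * q + k * q ^ 2 ≤ 0 := by
    have := mul_le_mul_of_nonneg_left hp (show 0 ≤ 8 * ν by positivity)
    rw [hA]; linarith
  have h6 : k * (16 * ν * (β * r ^ 2)) = A ^ 2 := by
    rw [hk, hK]; field_simp
  have h7 : 0 < 8 * ν * (β * r ^ 2) := by positivity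
  set w := 8 * ν * (β * r ^ 2) with hw
  have h8 : 2 * k * w = A ^ 2 := by rw [hw]; linarith
  have h9 := mul_le_mul_of_nonneg_left h5 h7.le
  have h10 : w * (w - A * q + k * q ^ 2) = ((w - A * q) ^ 2 + w ^ 2) / 2 := by
    linear_combination (q ^ 2 / 2) * h8
  have h11 : 0 < w ^ 2 := by positivity
  have h12 := sq_nonneg (w - A * q)
  rw [h10, mul_zero] at h9
  linarith

theorem exterior_ball {n : ℕ} (hn : 0 < n) (Ω : Set (E n)) (m r₀ : ℝ)
    (hL : IsLipschitzDomain hn Ω m r₀) (y : E n) (hy : y ∈ frontier Ω) (r : ℝ) (hr : 0 < r)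
    (hr0 : r ≤ r₀ / 2) :
    ∃ z : E n, ‖z - y‖ ≤ r / 8 ∧
      ∀ x ∈ closure Ω, ‖x - y‖ < 2 * r → (r / 8 / (1 + |m|)) ^ 2 ≤ ‖x - z‖ ^ 2 := by
  obtain ⟨hΩ, -, -, hm, hr₀, hloc⟩ := hL
  obtain ⟨T, φ, hφ, hiff⟩ := hloc y hy
  set N : Fin n := ⟨n - 1, Nat.sub_lt hn Nat.one_pos⟩ with hN
  set P : E n → E (n - 1) := fun p => (EuclideanSpace.equiv (Fin (n - 1)) ℝ).symm
    (fun i => p (Fin.castLE (Nat.sub_le n 1) i)) with hP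
  have hyΩ : y ∉ Ω := by
    have := hy.2
    rwa [hΩ.interior_eq] at this
  have hP0 : P 0 = 0 := by ext i; simp [hP]
  have hφ0 : 0 ≤ φ 0 := by
    by_contra h
    push Not at h
    refine hyΩ ((hiff y).mpr ⟨by simpa using hr₀, ?_⟩).1
    change φ (P (T (y - y))) < T (y - y) N
    simp only [sub_self, map_zero, hP0]
    simpa using h
  have hPle : ∀ q : E n, ‖P q‖ ≤ ‖q‖ := by
    intro q
    apply abs_le_of_sq_le_sq' _ (norm_nonneg _) |>.2
    rw [EuclideanSpace.norm_sq_eq, EuclideanSpace.norm_sq_eq]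
    have : ∑ i, ‖P q i‖ ^ 2 =
        ∑ i ∈ Finset.univ.map ⟨Fin.castLE (Nat.sub_le n 1), Fin.castLE_injective _⟩, ‖q i‖ ^ 2 := by
      rw [Finset.sum_map]
      rfl
    rw [this]
    exact Finset.sum_le_sum_of_subset_of_nonneg (Finset.subset_univ _) fun _ _ _ => sq_nonneg _
  set e : E n := EuclideanSpace.single N (r / 8) with he
  refine ⟨y - T.symm e, ?_, ?_⟩
  · rw [sub_sub_cancel_left, norm_neg, LinearIsometryEquiv.norm_map, he,
      PiLp.norm_single, Real.norm_eq_abs, abs_of_pos (by positivity)]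
  intro x hx hxy
  -- first for points of Ω
  have key : ∀ x ∈ Ω, ‖x - y‖ < 2 * r → (r / 8 / (1 + |m|)) ≤ ‖x - (y - T.symm e)‖ := by
    intro x hx hxy
    have h1 := ((hiff x).mp ⟨hx, by simpa [dist_eq_norm] using (by linarith : ‖x - y‖ < r₀)⟩).2
    change φ (P (T (x - y))) < T (x - y) N at h1
    set q := T (x - (y - T.symm e)) with hq
    have hqn : ‖q‖ = ‖x - (y - T.symm e)‖ := LinearIsometryEquiv.norm_map _ _
    have hqe : T (x - y) = q - e := by
      rw [hq]
      have : x - (y - T.symm e) = (x - y) + T.symm e := by abel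
      rw [this, map_add]; simp
    have hPq : P (q - e) = P q := by
      ext i
      have : Fin.castLE (Nat.sub_le n 1) i ≠ N := by
        intro h
        have := congrArg Fin.val h
        simp [hN] at this
        omega
      simp [hP, he, this]
    rw [hqe, hPq] at h1
    have h2 : (q - e) N = q N - r / 8 := by simp [he]
    have h3 : q N ≤ ‖q‖ := (le_abs_self _).trans (PiLp.norm_apply_le q N)
    have h4 : φ 0 - φ (P q) ≤ m * ‖P q‖ := by
      have := hφ.dist_le_mul 0 (P q)
      rw [Real.dist_eq, dist_zero_left, Real.coe_toNNReal _ hm.le] at this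
      exact (le_abs_self _).trans this
    have h5 := mul_le_mul_of_nonneg_left (hPle q) hm.le
    rw [← hqn, div_le_iff₀ (by positivity), abs_of_pos hm]
    rw [h2] at h1
    linarith
  have hcl : (r / 8 / (1 + |m|)) ≤ ‖x - (y - T.symm e)‖ := by
    have hx' : x ∈ closure (Ω ∩ {x | ‖x - y‖ < 2 * r}) := by
      have ho : IsOpen {x : E n | ‖x - y‖ < 2 * r} := isOpen_lt (by fun_prop) continuous_const
      have := ho.inter_closure (t := Ω) ⟨hxy, hx⟩
      rwa [inter_comm] at this
    have hc : IsClosed {x : E n | (r / 8 / (1 + |m|)) ≤ ‖x - (y - T.symm e)‖} :=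
      isClosed_le continuous_const (by fun_prop)
    exact closure_minimal (fun x hx => key x hx.1 hx.2) hc hx'
  exact pow_le_pow_left₀ (by positivity) hcl 2

theorem one_side (n : ℕ) (hn : 0 < n) (ν : ℝ) (hν : 0 < ν) (m β K : ℝ)
    (hβ : β = 1 / (64 * (1 + |m|) ^ 2))
    (hK : K = (8 * ν + 4 * n * ν⁻¹ + 1) ^ 2 / (16 * ν * β))
    (r₀ : ℝ) (Ω : Set (E n)) (hL : IsLipschitzDomain hn Ω m r₀)
    (a : E n × ℝ → Fin n → Fin n → ℝ) (ha : IsParabolicCoeff ν a (closure (Cyl Ω)))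
    (Y : E n × ℝ) (hY : Y ∈ pB Ω) (r : ℝ) (hr : 0 < r) (hr0 : r ≤ r₀ / 2)
    (u : E n × ℝ → ℝ) (hu : ContinuousOn u (closure (Cyl Ω ∩ Cr Y (2 * r))))
    (hbd : ∃ M : ℝ, ∀ X ∈ closure (Cyl Ω ∩ Cr Y (2 * r)), |u X| ≤ M)
    (hS : SolvesL a u (Cyl Ω ∩ Cr Y (2 * r)))
    (h0 : ∀ Z ∈ pB Ω ∩ Cr Y (2 * r), u Z = 0) :
    sSup ((fun X => max (u X) 0) '' (Cyl Ω ∩ Cr Y r)) ≤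
      (1 - Real.exp (-(5 * K)) / 225) *
        sSup ((fun X => max (u X) 0) '' (Cyl Ω ∩ Cr Y (2 * r))) := by
  have hβ0 : 0 < β := by rw [hβ]; positivity
  have hβ1 : β ≤ 1 / 64 := by
    rw [hβ]
    apply one_div_le_one_div_of_le (by norm_num)
    nlinarith [abs_nonneg m]
  have hK0 : 0 < K := by rw [hK]; positivity
  have hθ : 0 ≤ 1 - Real.exp (-(5 * K)) / 225 := by
    have : Real.exp (-(5 * K)) ≤ 1 := Real.exp_le_one_iff.mpr (by linarith)
    linarith
  have hr2 : 0 < r ^ 2 := by positivity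
  obtain ⟨y, s⟩ := Y
  set S := Cyl Ω ∩ Cr (y, s) (2 * r) with hSdef
  set σ := sSup ((fun X => max (u X) 0) '' S) with hσ
  have hσ0 : 0 ≤ σ := Real.sSup_nonneg (by rintro _ ⟨X, -, rfl⟩; exact le_max_right _ _)
  have hle : ∀ X ∈ S, u X ≤ σ := by
    intro X hX
    obtain ⟨M, hM⟩ := hbd
    refine (le_max_left (u X) 0).trans (le_csSup ⟨max M 0, ?_⟩ ⟨X, hX, rfl⟩)
    rintro _ ⟨Z, hZ, rfl⟩
    exact max_le_max_right 0 ((le_abs_self _).trans (hM Z (subset_closure hZ)))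
  have hex : ∃ (z : E n) (b : ℝ), ‖z - y‖ ≤ r / 8 ∧ 2 * r ^ 2 ≤ b ∧ b ≤ 2.02 * r ^ 2 ∧
      (∀ t, 0 ≤ t → s - 4 * r ^ 2 ≤ t → β * r ^ 2 ≤ b + (t - s) / 2) ∧
      (0 ≤ s - 4 * r ^ 2 → ∀ x ∈ closure Ω, ‖x - y‖ < 2 * r → b - 2 * r ^ 2 ≤ ‖x - z‖ ^ 2) := by
    have hβr : β * r ^ 2 ≤ 1 / 64 * r ^ 2 := mul_le_mul_of_nonneg_right hβ1 hr2.le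
    have hβr0 : 0 < β * r ^ 2 := by positivity
    rcases hY with ⟨hy, -⟩ | ⟨-, hs⟩
    · obtain ⟨z, hz1, hz2⟩ := exterior_ball hn Ω m r₀ hL y hy r hr hr0
      refine ⟨z, 2 * r ^ 2 + β * r ^ 2, hz1, by linarith, by linarith,
        fun t _ ht => by linarith, fun _ x hx hxy => ?_⟩
      have := hz2 x hx hxy
      have e : (r / 8 / (1 + |m|)) ^ 2 = β * r ^ 2 := by
        rw [hβ]; field_simp; norm_num
      linarith
    · simp only [mem_singleton_iff] at hs
      subst hs
      refine ⟨y, 2 * r ^ 2, by simp; positivity, le_rfl, by linarith,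
        fun t ht _ => by linarith, fun h => by linarith⟩
  obtain ⟨z, b, hz, hb1, hb2, hpos, hinit⟩ := hex
  refine Real.sSup_le ?_ (mul_nonneg hθ hσ0)
  rintro _ ⟨X, hX, rfl⟩
  refine max_le ?_ (mul_nonneg hθ hσ0)
  refine le_of_forall_pos_le_add fun ε hε => ?_
  have := core ν hν β K hβ0 hK Ω hL.1 a ha y s r hr z b hz hb1 hb2 hpos hinit u hu hS h0
    (σ + ε) (by linarith) (fun X hX => by linarith [hle X hX]) X hX
  have h1 : (1 - Real.exp (-(5 * K)) / 225) * ε ≤ 1 * ε := by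
    apply mul_le_mul_of_nonneg_right _ hε.le
    have := Real.exp_pos (-(5 * K))
    linarith
  linarith

theorem SolvesL_neg {n : ℕ} (a : E n × ℝ → Fin n → Fin n → ℝ) (u : E n × ℝ → ℝ)
    (V : Set (E n × ℝ)) (h : SolvesL a u V) : SolvesL a (fun X => - u X) V := by
  refine ⟨fun X hX => ⟨(h.1 X hX).1.neg, (h.1 X hX).2.neg⟩, fun X hX => ?_⟩
  have h1 := h.2 X hX
  have e1 : ∀ i j, D2 (fun X => - u X) X i j = - D2 u X i j := by
    intro i j
    unfold D2
    have : (fun x => fderiv ℝ (fun x' => - u (x', X.2)) x (EuclideanSpace.single j 1)) =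
        fun x => - (fderiv ℝ (fun x' => u (x', X.2)) x (EuclideanSpace.single j 1)) := by
      funext x
      rw [fderiv_fun_neg]; rfl
    rw [this, fderiv_fun_neg]; rfl
  have e2 : Dt (fun X => - u X) X = - Dt u X := by
    unfold Dt
    simp
  unfold LVal at h1 ⊢
  simp only [e1, e2, mul_neg, Finset.sum_neg_distrib]
  linarith

/-- **Corollary 4.2 (Lipschitz domains)**: if `u` is continuous and bounded on
`cl(Q_{2r}(Y))`, solves `Lu = 0` in `Q_{2r}(Y)` (with `Q = Ω × (0,∞)`,
`Y = (y,s) ∈ ∂_pQ`, `0 < r ≤ r₀/2`), and vanishes on `Δ_{2r}(Y)`, then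
`sup_{Q_r(Y)} u^± ≤ θ · sup_{Q_{2r}(Y)} u^±` with `θ = θ(n, ν, m) ∈ (0,1)`. -/
theorem vanishing_decay_lipschitz (n : ℕ) (hn : 0 < n) (ν : ℝ)
    (hν : ν ∈ Ioc (0 : ℝ) 1) (m : ℝ) :
    ∃ θ : ℝ, θ ∈ Ioo (0 : ℝ) 1 ∧
      ∀ (r₀ : ℝ) (Ω : Set (E n)), IsLipschitzDomain hn Ω m r₀ →
      ∀ (a : E n × ℝ → Fin n → Fin n → ℝ), IsParabolicCoeff ν a (closure (Cyl Ω)) →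
      ∀ Y ∈ pB Ω, ∀ r : ℝ, 0 < r → r ≤ r₀ / 2 →
      ∀ u : E n × ℝ → ℝ,
        ContinuousOn u (closure (Cyl Ω ∩ Cr Y (2 * r))) →
        (∃ M : ℝ, ∀ X ∈ closure (Cyl Ω ∩ Cr Y (2 * r)), |u X| ≤ M) →
        SolvesL a u (Cyl Ω ∩ Cr Y (2 * r)) →
        (∀ Z ∈ pB Ω ∩ Cr Y (2 * r), u Z = 0) →
        (sSup ((fun X => max (u X) 0) '' (Cyl Ω ∩ Cr Y r)) ≤
          θ * sSup ((fun X => max (u X) 0) '' (Cyl Ω ∩ Cr Y (2 * r)))) ∧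
        (sSup ((fun X => max (-u X) 0) '' (Cyl Ω ∩ Cr Y r)) ≤
          θ * sSup ((fun X => max (-u X) 0) '' (Cyl Ω ∩ Cr Y (2 * r)))) := by
  have hν0 : 0 < ν := hν.1
  set β : ℝ := 1 / (64 * (1 + |m|) ^ 2) with hβ
  set K : ℝ := (8 * ν + 4 * n * ν⁻¹ + 1) ^ 2 / (16 * ν * β) with hK
  have hβ0 : 0 < β := by rw [hβ]; positivity
  have hK0 : 0 < K := by rw [hK]; positivity
  refine ⟨1 - Real.exp (-(5 * K)) / 225, ⟨?_, ?_⟩, ?_⟩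
  · have : Real.exp (-(5 * K)) ≤ 1 := Real.exp_le_one_iff.mpr (by linarith)
    linarith
  · have := Real.exp_pos (-(5 * K))
    linarith
  intro r₀ Ω hL a ha Y hY r hr hr0 u hu hbd hS h0
  refine ⟨one_side n hn ν hν0 m β K hβ hK r₀ Ω hL a ha Y hY r hr hr0 u hu hbd hS h0, ?_⟩
  exact one_side n hn ν hν0 m β K hβ hK r₀ Ω hL a ha Y hY r hr hr0 (fun X => - u X) hu.neg
    (by simpa using hbd) (SolvesL_neg a u _ hS) (fun Z hZ => by simp [h0 Z hZ])
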